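/- Let V and W be simple 𝔤₀-supermodules. There exists a non-zero homomorphism of 𝔤-supermodules from K(V) to K'(W) if and only if V ≅ Λ^max(𝔤₁) ⊗ W as 𝔤₀-supermodules. -/

import Mathlib

noncomputable section

open Module Function

/-- A complex Lie superalgebra `𝔤 = 𝔤₀̄ ⊕ 𝔤₁̄` equipped with a compatible `ℤ`-grading
`𝔤 = 𝔤₋₁ ⊕ 𝔤₀ ⊕ 𝔤₁`, i.e. `𝔤₀ = 𝔤₀̄`, `𝔤₁̄ = 𝔤₁ ⊕ 𝔤₋₁`, the pieces `𝔤±₁` are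
`𝔤₀̄`-submodules and `[𝔤₁,𝔤₁] = [𝔤₋₁,𝔤₋₁] = 0`.  The super skew-symmetry and the super
Jacobi identity are imposed on (parity-)homogeneous elements, as usual. -/
structure GLSA where
  carrier : Type
  [isACG : AddCommGroup carrier]
  [isMod : Module ℂ carrier]
  bracket : carrier →ₗ[ℂ] carrier →ₗ[ℂ] carrier
  gneg : Submodule ℂ carrier
  g0 : Submodule ℂ carrier
  gpos : Submodule ℂ carrier
  oddCompl : IsCompl g0 (gneg ⊔ gpos)
  disjNP : Disjoint gneg gpos
  br_00 : ∀ x ∈ g0, ∀ y ∈ g0, bracket x y ∈ g0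
  br_0p : ∀ x ∈ g0, ∀ y ∈ gpos, bracket x y ∈ gpos
  br_0n : ∀ x ∈ g0, ∀ y ∈ gneg, bracket x y ∈ gneg
  br_pn : ∀ x ∈ gpos, ∀ y ∈ gneg, bracket x y ∈ g0
  br_pp : ∀ x ∈ gpos, ∀ y ∈ gpos, bracket x y = 0
  br_nn : ∀ x ∈ gneg, ∀ y ∈ gneg, bracket x y = 0
  skew_e : ∀ x ∈ g0, ∀ y, bracket x y = - bracket y x
  skew_oo : ∀ x ∈ gneg ⊔ gpos, ∀ y ∈ gneg ⊔ gpos, bracket x y = bracket y x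
  jacobi_e : ∀ x y z : carrier, (x ∈ g0 ∨ y ∈ g0) →
    bracket x (bracket y z) = bracket (bracket x y) z + bracket y (bracket x z)
  jacobi_oo : ∀ x ∈ gneg ⊔ gpos, ∀ y ∈ gneg ⊔ gpos, ∀ z,
    bracket x (bracket y z) = bracket (bracket x y) z - bracket y (bracket x z)

attribute [instance] GLSA.isACG GLSA.isMod

/-- The odd part `𝔤₁̄ = 𝔤₋₁ ⊕ 𝔤₁` of `L`. -/
def GLSA.odd (L : GLSA) : Submodule ℂ L.carrier := L.gneg ⊔ L.gpos

/-- A `𝔤`-supermodule: a `ℤ₂`-graded complex vector space with a compatible action of the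
Lie superalgebra `L` (signs in the compatibility with the bracket are imposed on
homogeneous elements). -/
structure SMod (L : GLSA) where
  carrier : Type
  [isACG : AddCommGroup carrier]
  [isMod : Module ℂ carrier]
  act : L.carrier →ₗ[ℂ] carrier →ₗ[ℂ] carrier
  ev : Submodule ℂ carrier
  od : Submodule ℂ carrier
  grading : IsCompl ev od
  act_e_ev : ∀ x ∈ L.g0, ∀ m ∈ ev, act x m ∈ ev
  act_e_od : ∀ x ∈ L.g0, ∀ m ∈ od, act x m ∈ od
  act_o_ev : ∀ x ∈ L.odd, ∀ m ∈ ev, act x m ∈ od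
  act_o_od : ∀ x ∈ L.odd, ∀ m ∈ od, act x m ∈ ev
  act_br_e : ∀ x y : L.carrier, (x ∈ L.g0 ∨ y ∈ L.g0) → ∀ m,
    act (L.bracket x y) m = act x (act y m) - act y (act x m)
  act_br_oo : ∀ x ∈ L.odd, ∀ y ∈ L.odd, ∀ m,
    act (L.bracket x y) m = act x (act y m) + act y (act x m)

attribute [instance] SMod.isACG SMod.isMod

/-- A `𝔤₀̄`-supermodule: a `ℤ₂`-graded complex vector space with an action of the (purely
even) Lie algebra `𝔤₀̄ = 𝔤₀` preserving the grading. -/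
structure SMod0 (L : GLSA) where
  carrier : Type
  [isACG : AddCommGroup carrier]
  [isMod : Module ℂ carrier]
  act : ↥L.g0 →ₗ[ℂ] carrier →ₗ[ℂ] carrier
  ev : Submodule ℂ carrier
  od : Submodule ℂ carrier
  grading : IsCompl ev od
  act_ev : ∀ (x : L.g0), ∀ m ∈ ev, act x m ∈ ev
  act_od : ∀ (x : L.g0), ∀ m ∈ od, act x m ∈ od
  act_br : ∀ (x y : L.g0) (m : carrier),
    act ⟨L.bracket ↑x ↑y, L.br_00 ↑x x.2 ↑y y.2⟩ m = act x (act y m) - act y (act x m)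

attribute [instance] SMod0.isACG SMod0.isMod

/-- A homomorphism of `𝔤`-supermodules (homogeneous of degree zero). -/
structure SHom {L : GLSA} (M N : SMod L) where
  toLin : M.carrier →ₗ[ℂ] N.carrier
  map_ev : ∀ m ∈ M.ev, toLin m ∈ N.ev
  map_od : ∀ m ∈ M.od, toLin m ∈ N.od
  equivar : ∀ (x : L.carrier) (m : M.carrier), toLin (M.act x m) = N.act x (toLin m)

/-- Isomorphism of `𝔤`-supermodules. -/
def SIso {L : GLSA} (M N : SMod L) : Prop := ∃ f : SHom M N, Bijective f.toLin

/-- Isomorphism of `𝔤₀̄`-supermodules. -/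
def SIso0 {L : GLSA} (V W : SMod0 L) : Prop :=
  ∃ e : V.carrier ≃ₗ[ℂ] W.carrier,
    (∀ v ∈ V.ev, e v ∈ W.ev) ∧ (∀ v ∈ V.od, e v ∈ W.od) ∧
    (∀ (x : L.g0) (v : V.carrier), e (V.act x v) = W.act x (e v))

/-- Isomorphism of `𝔤`-supermodules up to parity change. -/
def SIsoUpToParity {L : GLSA} (M N : SMod L) : Prop :=
  ∃ e : M.carrier ≃ₗ[ℂ] N.carrier,
    (∀ (x : L.carrier) (m : M.carrier), e (M.act x m) = N.act x (e m)) ∧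
    (((∀ m ∈ M.ev, e m ∈ N.ev) ∧ (∀ m ∈ M.od, e m ∈ N.od)) ∨
     ((∀ m ∈ M.ev, e m ∈ N.od) ∧ (∀ m ∈ M.od, e m ∈ N.ev)))

namespace SMod

variable {L : GLSA}

/-- A (graded) sub-supermodule of a `𝔤`-supermodule. -/
def IsSubmod (M : SMod L) (N : Submodule ℂ M.carrier) : Prop :=
  (∀ (x : L.carrier), ∀ m ∈ N, M.act x m ∈ N) ∧ N ≤ (N ⊓ M.ev) ⊔ (N ⊓ M.od)

/-- A simple sub-supermodule. -/
def IsSimpleSub (M : SMod L) (N : Submodule ℂ M.carrier) : Prop :=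
  M.IsSubmod N ∧ N ≠ ⊥ ∧ ∀ N', M.IsSubmod N' → N' ≤ N → N' = ⊥ ∨ N' = N

/-- The socle: the sum of all simple sub-supermodules. -/
def socle (M : SMod L) : Submodule ℂ M.carrier := sSup {N | M.IsSimpleSub N}

/-- The sub-supermodule generated by a subspace, i.e. `U(𝔤)·S`. -/
def gen (M : SMod L) (S : Submodule ℂ M.carrier) : Submodule ℂ M.carrier :=
  sInf {N | M.IsSubmod N ∧ S ≤ N}

/-- Simplicity of a `𝔤`-supermodule. -/
def IsSimple (M : SMod L) : Prop :=
  (⊤ : Submodule ℂ M.carrier) ≠ ⊥ ∧ ∀ N, M.IsSubmod N → N = ⊥ ∨ N = ⊤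

/-- Indecomposability of a `𝔤`-supermodule. -/
def Indecomposable (M : SMod L) : Prop :=
  (⊤ : Submodule ℂ M.carrier) ≠ ⊥ ∧
  ∀ N₁ N₂, M.IsSubmod N₁ → M.IsSubmod N₂ → N₁ ⊓ N₂ = ⊥ → N₁ ⊔ N₂ = ⊤ →
    N₁ = ⊥ ∨ N₂ = ⊥

/-- The parity change functor `Π`. -/
def pshift (M : SMod L) : SMod L where
  carrier := M.carrier
  act := M.act
  ev := M.od
  od := M.ev
  grading := M.grading.symm
  act_e_ev := M.act_e_od
  act_e_od := M.act_e_ev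
  act_o_ev := M.act_o_od
  act_o_od := M.act_o_ev
  act_br_e := M.act_br_e
  act_br_oo := M.act_br_oo

/-- The space `M^{𝔤₁}` of `𝔤₁`-invariants. -/
def invPos (M : SMod L) : Submodule ℂ M.carrier where
  carrier := {m | ∀ x ∈ L.gpos, M.act x m = 0}
  add_mem' := by
    intro a b ha hb x hx
    rw [map_add, ha x hx, hb x hx, add_zero]
  zero_mem' := by intro x hx; simp
  smul_mem' := by
    intro c a ha x hx
    rw [map_smul, ha x hx, smul_zero]

/-- The space `M^{𝔤₋₁}` of `𝔤₋₁`-invariants. -/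
def invNeg (M : SMod L) : Submodule ℂ M.carrier where
  carrier := {m | ∀ x ∈ L.gneg, M.act x m = 0}
  add_mem' := by
    intro a b ha hb x hx
    rw [map_add, ha x hx, hb x hx, add_zero]
  zero_mem' := by intro x hx; simp
  smul_mem' := by
    intro c a ha x hx
    rw [map_smul, ha x hx, smul_zero]

/-- Iterated action of a list of elements of `𝔤`. -/
def actList (M : SMod L) : List L.carrier → M.carrier → M.carrier
  | [], m => m
  | x :: xs, m => M.act x (M.actList xs m)

end SMod

namespace SMod0

variable {L : GLSA}

/-- A (graded) sub-supermodule of a `𝔤₀̄`-supermodule. -/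
def IsSubmod (V : SMod0 L) (N : Submodule ℂ V.carrier) : Prop :=
  (∀ (x : L.g0), ∀ v ∈ N, V.act x v ∈ N) ∧ N ≤ (N ⊓ V.ev) ⊔ (N ⊓ V.od)

/-- Simplicity of a `𝔤₀̄`-supermodule. -/
def IsSimple (V : SMod0 L) : Prop :=
  (⊤ : Submodule ℂ V.carrier) ≠ ⊥ ∧ ∀ N, V.IsSubmod N → N = ⊥ ∨ N = ⊤

end SMod0

/-- `IsKac V K η` expresses that `K`, together with the (even, `𝔤₀̄`-equivariant) unit map
`η : V → K` whose image is annihilated by `𝔤₁`, is *the* Kac module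
`K(V) = Ind_{𝔤≥0}^{𝔤} V` of the `𝔤₀̄`-supermodule `V` (on which `𝔤₁` acts by zero), i.e.
satisfies the universal property `Hom_𝔤(K(V), M) = Hom_{𝔤₀̄}(V, M^{𝔤₁})`. -/
structure IsKac {L : GLSA} (V : SMod0 L) (K : SMod L) (η : V.carrier →ₗ[ℂ] K.carrier) : Prop where
  map_ev : ∀ v ∈ V.ev, η v ∈ K.ev
  map_od : ∀ v ∈ V.od, η v ∈ K.od
  equivar : ∀ (x : L.g0) (v : V.carrier), η (V.act x v) = K.act ↑x (η v)
  pos_zero : ∀ x ∈ L.gpos, ∀ v : V.carrier, K.act x (η v) = 0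
  injective : Injective η
  generates : K.gen (LinearMap.range η) = ⊤
  universal : ∀ (M : SMod L) (φ : V.carrier →ₗ[ℂ] M.carrier),
    (∀ v ∈ V.ev, φ v ∈ M.ev) → (∀ v ∈ V.od, φ v ∈ M.od) →
    (∀ (x : L.g0) (v : V.carrier), φ (V.act x v) = M.act ↑x (φ v)) →
    (∀ x ∈ L.gpos, ∀ v : V.carrier, M.act x (φ v) = 0) →
    ∃! Φ : SHom K M, ∀ v, Φ.toLin (η v) = φ v

/-- The opposite Kac module `K'(V) = Ind_{𝔤≤0}^{𝔤} V` (with `𝔤₋₁` acting by zero on `V`),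
described by its universal property. -/
structure IsKac' {L : GLSA} (V : SMod0 L) (K : SMod L) (η : V.carrier →ₗ[ℂ] K.carrier) : Prop where
  map_ev : ∀ v ∈ V.ev, η v ∈ K.ev
  map_od : ∀ v ∈ V.od, η v ∈ K.od
  equivar : ∀ (x : L.g0) (v : V.carrier), η (V.act x v) = K.act ↑x (η v)
  neg_zero : ∀ x ∈ L.gneg, ∀ v : V.carrier, K.act x (η v) = 0
  injective : Injective η
  generates : K.gen (LinearMap.range η) = ⊤
  universal : ∀ (M : SMod L) (φ : V.carrier →ₗ[ℂ] M.carrier),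
    (∀ v ∈ V.ev, φ v ∈ M.ev) → (∀ v ∈ V.od, φ v ∈ M.od) →
    (∀ (x : L.g0) (v : V.carrier), φ (V.act x v) = M.act ↑x (φ v)) →
    (∀ x ∈ L.gneg, ∀ v : V.carrier, M.act x (φ v) = 0) →
    ∃! Φ : SHom K M, ∀ v, Φ.toLin (η v) = φ v

/-- `IsCoindPos W C ε` expresses that `C`, together with the (even, `𝔤₀̄`-equivariant)
counit `ε : C → W` killing `𝔤₁·C`, is the coinduced module `Coind_{𝔤≥0}^{𝔤}(W)` of the
`𝔤₀̄`-supermodule `W` (with `𝔤₁` acting by zero), i.e. satisfies the universal property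
`Hom_𝔤(M, Coind(W)) = Hom_{𝔤≥0}(Res M, W)`. -/
structure IsCoindPos {L : GLSA} (W : SMod0 L) (C : SMod L) (ε : C.carrier →ₗ[ℂ] W.carrier) : Prop where
  map_ev : ∀ c ∈ C.ev, ε c ∈ W.ev
  map_od : ∀ c ∈ C.od, ε c ∈ W.od
  equivar : ∀ (x : L.g0) (c : C.carrier), ε (C.act ↑x c) = W.act x (ε c)
  pos_zero : ∀ x ∈ L.gpos, ∀ c : C.carrier, ε (C.act x c) = 0
  universal : ∀ (M : SMod L) (ψ : M.carrier →ₗ[ℂ] W.carrier),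
    (∀ m ∈ M.ev, ψ m ∈ W.ev) → (∀ m ∈ M.od, ψ m ∈ W.od) →
    (∀ (x : L.g0) (m : M.carrier), ψ (M.act ↑x m) = W.act x (ψ m)) →
    (∀ x ∈ L.gpos, ∀ m : M.carrier, ψ (M.act x m) = 0) →
    ∃! Φ : SHom M C, ∀ m, ε (Φ.toLin m) = ψ m

/-- `Coind_{𝔤≤0}^{𝔤}(W)`, by its universal property. -/
structure IsCoindNeg {L : GLSA} (W : SMod0 L) (C : SMod L) (ε : C.carrier →ₗ[ℂ] W.carrier) : Prop where
  map_ev : ∀ c ∈ C.ev, ε c ∈ W.ev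
  map_od : ∀ c ∈ C.od, ε c ∈ W.od
  equivar : ∀ (x : L.g0) (c : C.carrier), ε (C.act ↑x c) = W.act x (ε c)
  neg_zero : ∀ x ∈ L.gneg, ∀ c : C.carrier, ε (C.act x c) = 0
  universal : ∀ (M : SMod L) (ψ : M.carrier →ₗ[ℂ] W.carrier),
    (∀ m ∈ M.ev, ψ m ∈ W.ev) → (∀ m ∈ M.od, ψ m ∈ W.od) →
    (∀ (x : L.g0) (m : M.carrier), ψ (M.act ↑x m) = W.act x (ψ m)) →
    (∀ x ∈ L.gneg, ∀ m : M.carrier, ψ (M.act x m) = 0) →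
    ∃! Φ : SHom M C, ∀ m, ε (Φ.toLin m) = ψ m

/-- The subspace `Λ^max(𝔤₋₁) ⊗ V ⊆ K(V)`: the span of all elements obtained by acting on
`η(V)` with `dim 𝔤₋₁` many elements of `𝔤₋₁`. -/
def botPartNeg {L : GLSA} (V : SMod0 L) (K : SMod L) (η : V.carrier →ₗ[ℂ] K.carrier) :
    Submodule ℂ K.carrier :=
  Submodule.span ℂ {m | ∃ (xs : List L.carrier) (v : V.carrier),
    xs.length = finrank ℂ ↥L.gneg ∧ (∀ x ∈ xs, x ∈ L.gneg) ∧ m = K.actList xs (η v)}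

/-- The subspace `Λ^max(𝔤₁) ⊗ V ⊆ K'(V)`. -/
def botPartPos {L : GLSA} (V : SMod0 L) (K : SMod L) (η : V.carrier →ₗ[ℂ] K.carrier) :
    Submodule ℂ K.carrier :=
  Submodule.span ℂ {m | ∃ (xs : List L.carrier) (v : V.carrier),
    xs.length = finrank ℂ ↥L.gpos ∧ (∀ x ∈ xs, x ∈ L.gpos) ∧ m = K.actList xs (η v)}

/-- For `x ∈ 𝔤₀̄`, the operator `ad x` restricted to `𝔤₁`. -/
def adPos (L : GLSA) (x : L.g0) : ↥L.gpos →ₗ[ℂ] ↥L.gpos :=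
  (L.bracket ↑x).restrict (fun y hy => L.br_0p ↑x x.2 y hy)

/-- For `x ∈ 𝔤₀̄`, the operator `ad x` restricted to `𝔤₋₁`. -/
def adNeg (L : GLSA) (x : L.g0) : ↥L.gneg →ₗ[ℂ] ↥L.gneg :=
  (L.bracket ↑x).restrict (fun y hy => L.br_0n ↑x x.2 y hy)

/-- The character by which `𝔤₀̄` acts on the one-dimensional module `Λ^max(𝔤₁)`. -/
def traceCharPos (L : GLSA) (x : L.g0) : ℂ := LinearMap.trace ℂ ↥L.gpos (adPos L x)

/-- The character by which `𝔤₀̄` acts on the one-dimensional module `Λ^max(𝔤₋₁)`. -/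
def traceCharNeg (L : GLSA) (x : L.g0) : ℂ := LinearMap.trace ℂ ↥L.gneg (adNeg L x)

/-- `IsTwistBy V W χ swap` expresses that `W ≅ ℂ_χ ⊗ V` as `𝔤₀̄`-supermodules, where `ℂ_χ`
is the one-dimensional module with character `χ`, of odd parity iff `swap = true`.
Taking `χ` to be `traceCharPos`/`traceCharNeg` (resp. their negatives) and `swap` the parity
of `dim 𝔤±₁` expresses `W ≅ Λ^max(𝔤±₁) ⊗ V` (resp. `W ≅ Λ^max(𝔤±₁^*) ⊗ V`). -/
def IsTwistBy {L : GLSA} (V W : SMod0 L) (χ : ↥L.g0 → ℂ) (swap : Bool) : Prop :=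
  ∃ e : V.carrier ≃ₗ[ℂ] W.carrier,
    (∀ (x : L.g0) (v : V.carrier), W.act x (e v) = e (V.act x v) + χ x • e v) ∧
    (if swap then (∀ v ∈ V.ev, e v ∈ W.od) ∧ (∀ v ∈ V.od, e v ∈ W.ev)
     else (∀ v ∈ V.ev, e v ∈ W.ev) ∧ (∀ v ∈ V.od, e v ∈ W.od))

/-- Parity (as a `Bool`) of `dim 𝔤₁`. -/
def parPos (L : GLSA) : Bool := (finrank ℂ ↥L.gpos) % 2 == 1

/-- Parity (as a `Bool`) of `dim 𝔤₋₁`. -/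
def parNeg (L : GLSA) : Bool := (finrank ℂ ↥L.gneg) % 2 == 1



namespace ExteriorTensor

open TensorProduct ExteriorAlgebra

variable {k E W N : Type*} [Field k] [AddCommGroup E] [Module k E] [AddCommGroup W] [Module k W]
  [AddCommGroup N] [Module k N]

/-- The inclusion `w ↦ 1 ⊗ w` of `W` in `Λ(E) ⊗ W`. -/
def incl (k E W : Type*) [Field k] [AddCommGroup E] [Module k E] [AddCommGroup W] [Module k W] :
    W →ₗ[k] ExteriorAlgebra k E ⊗[k] W :=
  TensorProduct.mk k (ExteriorAlgebra k E) W 1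

/-- Left multiplication by elements of `E` on `Λ(E) ⊗ W`. -/
def wedge (k E W : Type*) [Field k] [AddCommGroup E] [Module k E] [AddCommGroup W] [Module k W] :
    E →ₗ[k] Module.End k (ExteriorAlgebra k E ⊗[k] W) :=
  (Algebra.lsmul k k (ExteriorAlgebra k E ⊗[k] W)).toLinearMap ∘ₗ ι k

theorem wedge_apply (x : E) (m : ExteriorAlgebra k E ⊗[k] W) : wedge k E W x m = ι k x • m := rfl

theorem wedge_tmul (x : E) (a : ExteriorAlgebra k E) (w : W) :
    wedge k E W x (a ⊗ₜ w) = (ι k x * a) ⊗ₜ w := rfl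

theorem wedge_wedge_self (x : E) (m : ExteriorAlgebra k E ⊗[k] W) :
    wedge k E W x (wedge k E W x m) = 0 := by
  rw [wedge_apply, wedge_apply, smul_smul, ι_sq_zero, zero_smul]

theorem wedge_swap (x y : E) (m : ExteriorAlgebra k E ⊗[k] W) :
    wedge k E W x (wedge k E W y m) + wedge k E W y (wedge k E W x m) = 0 := by
  simp only [wedge_apply, smul_smul]
  rw [← add_smul, ι_add_mul_swap, zero_smul]

@[elab_as_elim]
theorem induction {p : ExteriorAlgebra k E ⊗[k] W → Prop} (incl : ∀ w, p (incl k E W w))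
    (add : ∀ m n, p m → p n → p (m + n)) (wedge : ∀ x m, p m → p (wedge k E W x m)) (m) : p m := by
  induction m with
  | zero => simpa using incl 0
  | add m n hm hn => exact add m n hm hn
  | tmul a w =>
    induction a using CliffordAlgebra.left_induction generalizing w with
    | algebraMap r =>
      have := incl (r • w)
      rwa [ExteriorTensor.incl, mk_apply, ← smul_tmul, ← Algebra.algebraMap_eq_smul_one] at this
    | add a b ha hb => rw [add_tmul]; exact add _ _ (ha w) (hb w)
    | ι_mul a x ha => exact wedge x _ (ha w)

theorem hom_ext {f g : ExteriorAlgebra k E ⊗[k] W →ₗ[k] N}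
    (h₁ : ∀ w, f (incl k E W w) = g (incl k E W w))
    (h₂ : ∀ x m, f m = g m → f (wedge k E W x m) = g (wedge k E W x m)) : f = g := by
  refine LinearMap.ext fun m => ?_
  induction m using ExteriorTensor.induction with
  | incl w => exact h₁ w
  | add m n hm hn => rw [map_add, map_add, hm, hn]
  | wedge x m hm => exact h₂ x m hm

section recursion

variable (n₀ : W →ₗ[k] N) (g : E →ₗ[k] ExteriorAlgebra k E ⊗[k] W →ₗ[k] N)
  (s : E →ₗ[k] N →ₗ[k] N)

/-- The step function underlying `ExteriorTensor.fold`. -/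
def step : E →ₗ[k] ExteriorAlgebra k E × (W →ₗ[k] N) →ₗ[k] (W →ₗ[k] N) :=
  LinearMap.mk₂ k (fun x p => g x ∘ₗ TensorProduct.mk k (ExteriorAlgebra k E) W p.1 + s x ∘ₗ p.2)
    (fun x y p => by ext; simp; abel) (fun c x p => by ext; simp)
    (fun x p q => by ext; simp; abel) (fun c x p => by ext; simp)

theorem step_step {g : E →ₗ[k] ExteriorAlgebra k E ⊗[k] W →ₗ[k] N} {s : E →ₗ[k] N →ₗ[k] N}
    (h : ∀ x m n, g x (wedge k E W x m) + s x (g x m + s x n) = 0)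
    (x : E) (a : ExteriorAlgebra k E) (ν : W →ₗ[k] N) :
    step g s x (ι k x * a, step g s x (a, ν)) = (0 : QuadraticForm k E) x • ν := by
  ext w
  simpa [step, wedge_tmul] using h x (a ⊗ₜ w) (ν w)

variable {g s} (h : ∀ x m n, g x (wedge k E W x m) + s x (g x m + s x n) = 0)

/-- The linear map on `Λ(E) ⊗ W` determined recursively by `F (1 ⊗ w) = n₀ w` and
`F (x ∧ m) = g x m + s x (F m)`. -/
def fold : ExteriorAlgebra k E ⊗[k] W →ₗ[k] N :=
  TensorProduct.lift (CliffordAlgebra.foldr' 0 (step g s) (step_step h) n₀)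

theorem fold_incl (w : W) : fold n₀ h (incl k E W w) = n₀ w := by
  have := CliffordAlgebra.foldr'_algebraMap (0 : QuadraticForm k E) (step g s) (step_step h) n₀ 1
  rw [map_one, one_smul] at this
  simp only [fold, incl, mk_apply, lift.tmul]
  exact LinearMap.congr_fun this w

theorem fold_wedge (x : E) (m : ExteriorAlgebra k E ⊗[k] W) :
    fold n₀ h (wedge k E W x m) = g x m + s x (fold n₀ h m) := by
  induction m with
  | zero => simp
  | add m n hm hn => simp only [map_add, hm, hn]; abel
  | tmul a w =>
    rw [wedge_tmul]
    simp only [fold, lift.tmul]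
    exact LinearMap.congr_fun (CliffordAlgebra.foldr'_ι_mul 0 (step g s) (step_step h) n₀ x a) w

end recursion

section derivation

/-- The extension of an endomorphism of `E` and an endomorphism of `W` to `Λ(E) ⊗ W`
by the Leibniz rule. -/
def der (D : E →ₗ[k] E) (T : W →ₗ[k] W) : Module.End k (ExteriorAlgebra k E ⊗[k] W) :=
  fold (g := wedge k E W ∘ₗ D) (s := wedge k E W) (incl k E W ∘ₗ T) fun x m n => by
    simp only [LinearMap.comp_apply, map_add, wedge_wedge_self, add_zero]
    exact wedge_swap _ _ _

theorem der_incl (D : E →ₗ[k] E) (T : W →ₗ[k] W) (w : W) :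
    der D T (incl k E W w) = incl k E W (T w) := fold_incl _ _ _

theorem der_wedge (D : E →ₗ[k] E) (T : W →ₗ[k] W) (x : E) (m) :
    der D T (wedge k E W x m) = wedge k E W (D x) m + wedge k E W x (der D T m) :=
  fold_wedge _ _ _ _

/-- The extension of an endomorphism of `W` to `Λ(E) ⊗ W` anticommuting with `E`. -/
def anti (E : Type*) [AddCommGroup E] [Module k E] (T : W →ₗ[k] W) :
    Module.End k (ExteriorAlgebra k E ⊗[k] W) :=
  fold (g := 0) (s := (-1 : k) • wedge k E W) (incl k E W ∘ₗ T) fun x m n => by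
    simp [wedge_wedge_self]

theorem anti_incl (T : W →ₗ[k] W) (w : W) :
    anti E T (incl k E W w) = incl k E W (T w) := fold_incl _ _ _

theorem anti_wedge (T : W →ₗ[k] W) (x : E) (m) :
    anti E T (wedge k E W x m) = -wedge k E W x (anti E T m) :=
  (fold_wedge _ _ _ _).trans (by simp [anti])

/-- Contraction of `Λ(E) ⊗ W` with a linear form on `E`. -/
def contract (W : Type*) [AddCommGroup W] [Module k W] (d : E →ₗ[k] k) :
    Module.End k (ExteriorAlgebra k E ⊗[k] W) :=
  fold (g := d.smulRight (LinearMap.id : _ →ₗ[k] ExteriorAlgebra k E ⊗[k] W)) (s := (-1 : k) • wedge k E W) 0 fun x m n => by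
    simp [wedge_wedge_self]

theorem contract_wedge (d : E →ₗ[k] k) (x : E) (m) :
    contract W d (wedge k E W x m) = d x • m - wedge k E W x (contract W d m) :=
  (fold_wedge _ _ _ _).trans (by simp [contract, sub_eq_add_neg])

end derivation

theorem der_ιMulti (D : E →ₗ[k] E) (T : W →ₗ[k] W) {n : ℕ} (x : Fin n → E)
    (m : ExteriorAlgebra k E ⊗[k] W) :
    der D T (ιMulti k n x • m) =
      ∑ i, ιMulti k n (Function.update x i (D (x i))) • m + ιMulti k n x • der D T m := by
  induction n with
  | zero => simp
  | succ n ih =>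
    have key (i : Fin n) : (fun j => Function.update x i.succ (D (x i.succ)) (Fin.succ j)) =
        Function.update (fun j => x (Fin.succ j)) i (D (x i.succ)) :=
      Function.update_comp_eq_of_injective x (Fin.succ_injective n) i _
    rw [ιMulti_succ_apply, mul_smul, ← wedge_apply, der_wedge, Matrix.vecTail, ih,
      Fin.sum_univ_succ, map_add, map_sum]
    simp only [ιMulti_succ_apply, mul_smul, ← wedge_apply, Matrix.vecTail, Function.comp_def, key,
      Function.update_self, Function.update_of_ne (Fin.succ_ne_zero _),
      Function.update_of_ne (Fin.succ_ne_zero _).symm, add_assoc]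

theorem anti_ιMulti (T : W →ₗ[k] W) {n : ℕ} (x : Fin n → E) (m : ExteriorAlgebra k E ⊗[k] W) :
    anti E T (ιMulti k n x • m) = (-1 : k) ^ n • ιMulti k n x • anti E T m := by
  induction n with
  | zero => simp
  | succ n ih =>
    rw [ιMulti_succ_apply, mul_smul, ← wedge_apply, anti_wedge, ih]
    simp only [map_smul, wedge_apply, mul_smul, pow_succ]
    simp

theorem ιMulti_mul_ι {n : ℕ} (x : Fin n → E) (y : E) :
    ιMulti k n x * ι k y = (-1 : k) ^ n • (ι k y * ιMulti k n x) := by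
  induction n with
  | zero => simp
  | succ n ih =>
    rw [ιMulti_succ_apply, mul_assoc, Matrix.vecTail, ih, mul_smul_comm, ← mul_assoc, ← mul_assoc,
      eq_neg_of_add_eq_zero_left (ι_add_mul_swap (x 0) y), pow_succ]
    simp

theorem contract_ιMulti (d : E →ₗ[k] k) {n : ℕ} (x : Fin n → E) (hx : ∀ i, d (x i) = 0)
    (m : ExteriorAlgebra k E ⊗[k] W) :
    contract W d (ιMulti k n x • m) = (-1 : k) ^ n • ιMulti k n x • contract W d m := by
  induction n with
  | zero => simp
  | succ n ih =>
    rw [ιMulti_succ_apply, mul_smul, ← wedge_apply, contract_wedge, hx, Matrix.vecTail,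
      ih (x ∘ Fin.succ) fun i => hx i.succ]
    simp only [map_smul, wedge_apply, mul_smul, pow_succ]
    simp

theorem exists_ιMulti_smul_eq {n : ℕ} (x : Fin n → E) (d : Fin n → E →ₗ[k] k)
    (hd : ∀ i, d i (x i) = 1) (hd' : ∀ i j, i ≠ j → d i (x j) = 0)
    {m : ExteriorAlgebra k E ⊗[k] W} (hm : ∀ i, wedge k E W (x i) m = 0) :
    ∃ m', ιMulti k n x • m' = m := by
  induction n with
  | zero => exact ⟨m, by simp⟩
  | succ n ih =>
    obtain ⟨m', hm'⟩ := ih (fun i => x i.succ) (fun i => d i.succ) (fun i => hd _)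
      (fun i j hij => hd' _ _ (by simpa using hij)) fun i => hm _
    have h₀ := contract_wedge (d 0) (x 0) m
    rw [hm, hd, map_zero, one_smul, eq_comm, sub_eq_zero] at h₀
    refine ⟨(-1 : k) ^ n • contract W (d 0) m', ?_⟩
    rw [h₀, ← hm', contract_ιMulti _ _ fun i => hd' _ _ (Fin.succ_ne_zero i).symm,
      ιMulti_succ_apply, mul_smul, map_smul, wedge_apply, smul_comm _ ((-1 : k) ^ n),
      smul_comm _ ((-1 : k) ^ n)]
    rfl

/-- Replacing in turn each entry of an alternating map evaluated at a basis by its image under an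
endomorphism multiplies the value by the trace. -/
theorem sum_update_basis {n : ℕ} (b : Module.Basis (Fin n) k E) (D : E →ₗ[k] E)
    (f : E [⋀^Fin n]→ₗ[k] N) :
    ∑ i, f (Function.update b i (D (b i))) = LinearMap.trace k E D • f b := by
  rw [LinearMap.trace_eq_matrix_trace k b, Matrix.trace, Finset.sum_smul]
  refine Finset.sum_congr rfl fun i _ => ?_
  conv_lhs => rw [← b.sum_repr (D (b i))]
  rw [f.map_update_sum]
  rw [Finset.sum_eq_single i]
  · simp [f.map_update_smul, LinearMap.toMatrix_apply]
  · intro j _ hj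
    rw [f.map_update_smul, f.map_update_self _ hj.symm, smul_zero]
  · simp

section top

variable {n : ℕ} (b : Module.Basis (Fin n) k E)

/-- The map `w ↦ b₁ ∧ ⋯ ∧ bₙ ⊗ w`. -/
def top (W : Type*) [AddCommGroup W] [Module k W] : W →ₗ[k] ExteriorAlgebra k E ⊗[k] W :=
  TensorProduct.mk k _ W (ιMulti k n b)

theorem top_apply (w : W) : top b W w = ιMulti k n b • incl k E W w := by
  simp [top, incl, smul_tmul']

theorem der_top (D : E →ₗ[k] E) (T : W →ₗ[k] W) (w : W) :
    der D T (top b W w) = LinearMap.trace k E D • top b W w + top b W (T w) := by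
  simp only [top_apply]
  rw [der_ιMulti, der_incl, ← Finset.sum_smul, sum_update_basis, smul_assoc]

theorem anti_top (T : W →ₗ[k] W) (w : W) :
    anti E T (top b W w) = (-1 : k) ^ n • top b W (T w) := by
  rw [top_apply, top_apply, anti_ιMulti, anti_incl]

theorem ι_mul_ιMulti_basis (x : E) : ι k x * ιMulti k n b = 0 := by
  have : ιMulti k (n + 1) (Matrix.vecCons x b) = 0 := by
    refine AlternatingMap.map_linearDependent _ _ fun h => ?_
    have := Module.Finite.of_basis b
    have := h.fintype_card_le_finrank
    rw [Module.finrank_eq_card_basis b] at this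
    simp at this
  simpa [ιMulti_succ_apply] using this

theorem ιMulti_basis_mul_ι (x : E) : ιMulti k n b * ι k x = 0 := by
  rw [ιMulti_mul_ι, ι_mul_ιMulti_basis, smul_zero]

theorem wedge_top (x : E) (w : W) : wedge k E W x (top b W w) = 0 := by
  rw [top_apply, wedge_apply, smul_smul, ι_mul_ιMulti_basis, zero_smul]

/-- The coefficient of `b₁ ∧ ⋯ ∧ bₙ`. -/
def topCoeff (W : Type*) [AddCommGroup W] [Module k W] : ExteriorAlgebra k E ⊗[k] W →ₗ[k] W :=
  TensorProduct.lift ((LinearMap.lsmul k W) ∘ₗ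
    liftAlternating (Pi.single n b.det))

theorem topCoeff_top (w : W) : topCoeff b W (top b W w) = w := by
  simp only [top, topCoeff, mk_apply, lift.tmul, LinearMap.comp_apply,
    liftAlternating_apply_ιMulti]
  simp [b.det_self]

theorem exists_top_eq {m : ExteriorAlgebra k E ⊗[k] W} (hm : ∀ x, wedge k E W x m = 0) :
    ∃ w, top b W w = m := by
  obtain ⟨m', rfl⟩ := exists_ιMulti_smul_eq b b.coord (by simp)
    (fun i j hij => by simp [hij.symm]) fun i => hm _
  clear hm
  induction m' using ExteriorTensor.induction with
  | incl w => exact ⟨w, top_apply b w⟩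
  | add m n hm hn =>
    obtain ⟨v, hv⟩ := hm
    obtain ⟨w, hw⟩ := hn
    exact ⟨v + w, by rw [map_add, hv, hw, smul_add]⟩
  | wedge x m _ => exact ⟨0, by rw [wedge_apply, smul_smul, ιMulti_basis_mul_ι, zero_smul, map_zero]⟩

end top

end ExteriorTensor

section parity

variable {k E F : Type*} [Field k] [AddCommGroup E] [Module k E] [AddCommGroup F]
  [Module k F] {ev od : Submodule k E} {ev' od' : Submodule k F}

theorem eq_zero_of_eq_neg (k : Type*) {E : Type*} [Field k] [CharZero k] [AddCommGroup E]
    [Module k E] {m : E} (h : m = -m) : m = 0 := by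
  have : (2 : k) • m = 0 := by
    rw [two_smul]
    nth_rewrite 1 [h]
    exact neg_add_cancel m
  exact (smul_eq_zero.1 this).resolve_left two_ne_zero

/-- The parity involution of a `ℤ/2`-graded vector space. -/
def parityInv (h : IsCompl ev od) : E →ₗ[k] E := ev.projection od h - od.projection ev h.symm

theorem parityInv_of_mem_ev (h : IsCompl ev od) {m : E} (hm : m ∈ ev) : parityInv h m = m := by
  have h₁ := (Submodule.projection_apply_eq_zero_iff h.symm).2 hm
  have h₂ := Submodule.projection_apply_of_mem_left h hm
  simp [parityInv, h₁, h₂]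

theorem parityInv_of_mem_od (h : IsCompl ev od) {m : E} (hm : m ∈ od) : parityInv h m = -m := by
  have h₁ := (Submodule.projection_apply_eq_zero_iff h).2 hm
  have h₂ := Submodule.projection_apply_of_mem_left h.symm hm
  simp [parityInv, h₁, h₂]

theorem exists_add_of_grading (h : IsCompl ev od) (m : E) : ∃ a ∈ ev, ∃ b ∈ od, a + b = m :=
  Submodule.mem_sup.1 (h.sup_eq_top ▸ Submodule.mem_top)

theorem parityInv_parityInv (h : IsCompl ev od) (m : E) : parityInv h (parityInv h m) = m := by
  obtain ⟨a, ha, b, hb, rfl⟩ := exists_add_of_grading h m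
  simp [parityInv_of_mem_ev h ha, parityInv_of_mem_od h hb]

theorem mem_ev_iff [CharZero k] (h : IsCompl ev od) {m : E} : m ∈ ev ↔ parityInv h m = m := by
  refine ⟨parityInv_of_mem_ev h, fun hm => ?_⟩
  obtain ⟨a, ha, b, hb, rfl⟩ := exists_add_of_grading h m
  rw [map_add, parityInv_of_mem_ev h ha, parityInv_of_mem_od h hb, add_right_inj] at hm
  rw [eq_zero_of_eq_neg k hm.symm, add_zero]
  exact ha

theorem mem_od_iff [CharZero k] (h : IsCompl ev od) {m : E} : m ∈ od ↔ parityInv h m = -m := by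
  refine ⟨parityInv_of_mem_od h, fun hm => ?_⟩
  obtain ⟨a, ha, b, hb, rfl⟩ := exists_add_of_grading h m
  rw [map_add, parityInv_of_mem_ev h ha, parityInv_of_mem_od h hb, neg_add, add_left_inj] at hm
  rw [eq_zero_of_eq_neg k hm, zero_add]
  exact hb

theorem map_parityInv (h : IsCompl ev od) (h' : IsCompl ev' od') {f : E →ₗ[k] F}
    (h₀ : ∀ m ∈ ev, f m ∈ ev') (h₁ : ∀ m ∈ od, f m ∈ od') (m : E) :
    f (parityInv h m) = parityInv h' (f m) := by
  obtain ⟨a, ha, b, hb, rfl⟩ := exists_add_of_grading h m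
  simp [parityInv_of_mem_ev h ha, parityInv_of_mem_od h hb, parityInv_of_mem_ev h' (h₀ a ha),
    parityInv_of_mem_od h' (h₁ b hb)]

theorem map_parityInv_odd (h : IsCompl ev od) (h' : IsCompl ev' od') {f : E →ₗ[k] F}
    (h₀ : ∀ m ∈ ev, f m ∈ od') (h₁ : ∀ m ∈ od, f m ∈ ev') (m : E) :
    f (parityInv h m) = -parityInv h' (f m) := by
  obtain ⟨a, ha, b, hb, rfl⟩ := exists_add_of_grading h m
  simp [parityInv_of_mem_ev h ha, parityInv_of_mem_od h hb, parityInv_of_mem_od h' (h₀ a ha),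
    parityInv_of_mem_ev h' (h₁ b hb), add_comm]

theorem le_sup_of_parityInv_mem [CharZero k] (h : IsCompl ev od) {N : Submodule k E}
    (hN : ∀ m ∈ N, parityInv h m ∈ N) : N ≤ (N ⊓ ev) ⊔ (N ⊓ od) := by
  intro m hm
  have key : m = (2 : k)⁻¹ • (m + parityInv h m) + (2 : k)⁻¹ • (m - parityInv h m) := by
    module
  rw [key]
  refine Submodule.add_mem_sup ⟨N.smul_mem _ (N.add_mem hm (hN m hm)), ev.smul_mem _ ?_⟩
    ⟨N.smul_mem _ (N.sub_mem hm (hN m hm)), od.smul_mem _ ?_⟩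
  · rw [mem_ev_iff h, map_add, parityInv_parityInv, add_comm]
  · rw [mem_od_iff h, map_sub, parityInv_parityInv, neg_sub]

theorem isCompl_of_involutive [CharZero k] {P : E →ₗ[k] E} (hP : ∀ m, P (P m) = m) :
    IsCompl (LinearMap.eqLocus P LinearMap.id) (LinearMap.eqLocus P (-LinearMap.id)) := by
  refine ⟨Submodule.disjoint_def.2 fun m h₀ h₁ => ?_, codisjoint_iff.2 (eq_top_iff.2 fun m _ => ?_)⟩
  · simp only [LinearMap.mem_eqLocus, LinearMap.id_apply, LinearMap.neg_apply] at h₀ h₁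
    exact eq_zero_of_eq_neg k (h₀.symm.trans h₁)
  · have key : m = (2 : k)⁻¹ • (m + P m) + (2 : k)⁻¹ • (m - P m) := by module
    rw [key]
    refine Submodule.add_mem_sup (Submodule.smul_mem _ _ ?_) (Submodule.smul_mem _ _ ?_)
    · simp [hP, add_comm]
    · simp [hP]

end parity

namespace SHom

variable {L : GLSA} {M N P : SMod L}

/-- The identity homomorphism of a `𝔤`-supermodule. -/
def id (M : SMod L) : SHom M M := ⟨LinearMap.id, fun _ h => h, fun _ h => h, fun _ _ => rfl⟩

/-- Composition of homomorphisms of `𝔤`-supermodules. -/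
def comp (g : SHom N P) (f : SHom M N) : SHom M P where
  toLin := g.toLin ∘ₗ f.toLin
  map_ev m hm := g.map_ev _ (f.map_ev m hm)
  map_od m hm := g.map_od _ (f.map_od m hm)
  equivar x m := (congrArg g.toLin (f.equivar x m)).trans (g.equivar x _)

end SHom

section superalgebra

variable {L : GLSA}

namespace GLSA

theorem gpos_le_odd (L : GLSA) : L.gpos ≤ L.odd := le_sup_right

theorem gneg_le_odd (L : GLSA) : L.gneg ≤ L.odd := le_sup_left

theorem isCompl_gneg (L : GLSA) : IsCompl L.gneg (L.g0 ⊔ L.gpos) := by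
  refine ⟨?_, ?_⟩
  · rw [sup_comm]
    exact L.disjNP.disjoint_sup_right_of_disjoint_sup_left L.oddCompl.disjoint.symm
  · rw [codisjoint_iff, sup_left_comm]
    exact L.oddCompl.sup_eq_top

theorem isCompl_gpos (L : GLSA) : IsCompl L.gpos (L.g0 ⊔ L.gneg) := by
  refine ⟨?_, ?_⟩
  · rw [sup_comm]
    refine L.disjNP.symm.disjoint_sup_right_of_disjoint_sup_left ?_
    rw [sup_comm]
    exact L.oddCompl.disjoint.symm
  · rw [codisjoint_iff, sup_left_comm, sup_comm L.gpos]
    exact L.oddCompl.sup_eq_top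

theorem exists_eq_add (z : L.carrier) :
    ∃ (a : L.g0) (b : L.gneg) (c : L.gpos), z = a + (b + c) := by
  obtain ⟨a, ha, d, hd, rfl⟩ := exists_add_of_grading L.oddCompl z
  obtain ⟨b, hb, c, hc, rfl⟩ := Submodule.mem_sup.1 hd
  exact ⟨⟨a, ha⟩, ⟨b, hb⟩, ⟨c, hc⟩, rfl⟩

theorem exists_eq_add_of_mem_odd {z : L.carrier} (hz : z ∈ L.odd) :
    ∃ (b : L.gneg) (c : L.gpos), z = b + c := by
  obtain ⟨b, hb, c, hc, rfl⟩ := Submodule.mem_sup.1 hz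
  exact ⟨⟨b, hb⟩, ⟨c, hc⟩, rfl⟩

theorem bracket_neg_pos_mem (y : L.gneg) (x : L.gpos) : L.bracket y x ∈ L.g0 := by
  rw [L.skew_oo y (L.gneg_le_odd y.2) x (L.gpos_le_odd x.2)]
  exact L.br_pn x x.2 y y.2

/-- The bracket `𝔤₀ × 𝔤₀ → 𝔤₀`. -/
def bracketZero (L : GLSA) (x y : L.g0) : L.g0 := ⟨L.bracket x y, L.br_00 x x.2 y y.2⟩

/-- The bracket `𝔤₋₁ × 𝔤₁ → 𝔤₀`. -/
def bracketNegPos (L : GLSA) : L.gneg →ₗ[ℂ] L.gpos →ₗ[ℂ] L.g0 :=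
  LinearMap.mk₂ ℂ (fun y x => ⟨L.bracket y x, bracket_neg_pos_mem y x⟩)
    (fun y y' x => by ext; simp) (fun c y x => by ext; simp) (fun y x x' => by ext; simp)
    (fun c y x => by ext; simp)

theorem coe_bracketNegPos (y : L.gneg) (x : L.gpos) :
    (L.bracketNegPos y x : L.carrier) = L.bracket y x := rfl

theorem coe_adPos (h : L.g0) (x : L.gpos) : (adPos L h x : L.carrier) = L.bracket h x := rfl

theorem coe_adNeg (h : L.g0) (y : L.gneg) : (adNeg L h y : L.carrier) = L.bracket h y := rfl

theorem adPos_bracketZero (h h' : L.g0) (x : L.gpos) :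
    adPos L (L.bracketZero h h') x = adPos L h (adPos L h' x) - adPos L h' (adPos L h x) := by
  ext
  have := L.jacobi_e h h' x (Or.inl h.2)
  simp only [coe_adPos, AddSubgroupClass.coe_sub, bracketZero, this]
  abel

theorem adNeg_bracketNegPos (y y' : L.gneg) (x : L.gpos) :
    adNeg L (L.bracketNegPos y x) y' + adNeg L (L.bracketNegPos y' x) y = 0 := by
  ext
  have := L.jacobi_oo y (L.gneg_le_odd y.2) y' (L.gneg_le_odd y'.2) x
  rw [L.br_nn y y.2 y' y'.2, map_zero, LinearMap.zero_apply, zero_sub,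
    ← coe_bracketNegPos, ← coe_bracketNegPos] at this
  have h₁ := L.skew_e _ (L.bracketNegPos y x).2 y'
  have h₂ := L.skew_e _ (L.bracketNegPos y' x).2 y
  simp only [coe_adNeg, Submodule.coe_add, ZeroMemClass.coe_zero, h₁, h₂, this]
  abel

theorem adPos_bracketNegPos_self (y : L.gneg) (x : L.gpos) :
    adPos L (L.bracketNegPos y x) x = 0 := by
  ext
  have := L.jacobi_oo x (L.gpos_le_odd x.2) x (L.gpos_le_odd x.2) y
  rw [L.br_pp x x.2 x x.2, map_zero, LinearMap.zero_apply, zero_sub,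
    L.skew_oo x (L.gpos_le_odd x.2) y (L.gneg_le_odd y.2)] at this
  rw [coe_adPos, L.skew_e _ (L.bracketNegPos y x).2, coe_bracketNegPos, eq_zero_of_eq_neg ℂ this,
    neg_zero, ZeroMemClass.coe_zero]

theorem bracketZero_bracketNegPos (h : L.g0) (y : L.gneg) (x : L.gpos) :
    L.bracketZero h (L.bracketNegPos y x) =
      L.bracketNegPos (adNeg L h y) x + L.bracketNegPos y (adPos L h x) := by
  ext
  exact L.jacobi_e h y x (Or.inl h.2)

end GLSA

namespace SMod0

open TensorProduct ExteriorTensor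

variable (W : SMod0 L)

/-- The parity involution of a `𝔤₀`-supermodule. -/
abbrev parity : W.carrier →ₗ[ℂ] W.carrier := parityInv W.grading

theorem act_parity (x : L.g0) (w : W.carrier) : W.act x (W.parity w) = W.parity (W.act x w) :=
  map_parityInv W.grading W.grading (W.act_ev x) (W.act_od x) w

/-- The underlying space `Λ(𝔤₁) ⊗ W` of the opposite Kac module of `W`. -/
abbrev Kac' : Type := ExteriorAlgebra ℂ L.gpos ⊗[ℂ] W.carrier

/-- The action of `𝔤₀` on `Λ(𝔤₁) ⊗ W`. -/
def actZero : L.g0 →ₗ[ℂ] Module.End ℂ W.Kac' where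
  toFun x := der (adPos L x) (W.act x)
  map_add' x y := by
    refine hom_ext (fun w => ?_) fun z m hm => ?_
    · simp [der_incl]
    · have : adPos L (x + y) z = adPos L x z + adPos L y z := by ext; simp [GLSA.coe_adPos]
      rw [der_wedge, hm, this]
      simp only [der_wedge, LinearMap.add_apply, map_add]
      abel
  map_smul' c x := by
    refine hom_ext (fun w => ?_) fun z m hm => ?_
    · simp [der_incl]
    · have : adPos L (c • x) z = c • adPos L x z := by ext; simp [GLSA.coe_adPos]
      rw [der_wedge, hm, this]
      simp only [der_wedge, LinearMap.smul_apply, map_smul, RingHom.id_apply, smul_add]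

theorem actZero_incl (x : L.g0) (w : W.carrier) :
    W.actZero x (incl ℂ L.gpos _ w) = incl ℂ L.gpos _ (W.act x w) := der_incl _ _ _

theorem actZero_wedge (x : L.g0) (z : L.gpos) (m : W.Kac') :
    W.actZero x (wedge ℂ L.gpos _ z m) =
      wedge ℂ L.gpos _ (adPos L x z) m + wedge ℂ L.gpos _ z (W.actZero x m) := der_wedge _ _ _ _

theorem actNeg_aux (y : L.gneg) (x : L.gpos) (m n : W.Kac') :
    (W.actZero ∘ₗ L.bracketNegPos y) x (wedge ℂ L.gpos _ x m) +
      ((-1 : ℂ) • wedge ℂ L.gpos W.carrier) x ((W.actZero ∘ₗ L.bracketNegPos y) x m +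
        ((-1 : ℂ) • wedge ℂ L.gpos W.carrier) x n) = 0 := by
  simp [actZero_wedge, GLSA.adPos_bracketNegPos_self, wedge_wedge_self]

/-- The action of an element of `𝔤₋₁` on `Λ(𝔤₁) ⊗ W`. -/
def actNegAux (y : L.gneg) : Module.End ℂ W.Kac' :=
  fold (g := W.actZero ∘ₗ L.bracketNegPos y) (s := (-1 : ℂ) • wedge ℂ L.gpos W.carrier) 0
    (W.actNeg_aux y)

theorem actNegAux_incl (y : L.gneg) (w : W.carrier) :
    W.actNegAux y (incl ℂ L.gpos _ w) = 0 := fold_incl _ _ _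

theorem actNegAux_wedge (y : L.gneg) (x : L.gpos) (m : W.Kac') :
    W.actNegAux y (wedge ℂ L.gpos _ x m) =
      W.actZero (L.bracketNegPos y x) m - wedge ℂ L.gpos _ x (W.actNegAux y m) :=
  (fold_wedge _ _ _ _).trans (by simp [actNegAux, sub_eq_add_neg])

/-- The action of `𝔤₋₁` on `Λ(𝔤₁) ⊗ W`. -/
def actNeg : L.gneg →ₗ[ℂ] Module.End ℂ W.Kac' where
  toFun := W.actNegAux
  map_add' x y := by
    refine hom_ext (fun w => ?_) fun z m hm => ?_
    · simp [actNegAux_incl]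
    · simp only [actNegAux_wedge, hm, LinearMap.add_apply, map_add]
      abel
  map_smul' c x := by
    refine hom_ext (fun w => ?_) fun z m hm => ?_
    · simp [actNegAux_incl]
    · simp only [actNegAux_wedge, hm, LinearMap.smul_apply, map_smul, RingHom.id_apply, smul_sub]

theorem actNeg_incl (y : L.gneg) (w : W.carrier) :
    W.actNeg y (incl ℂ L.gpos _ w) = 0 := W.actNegAux_incl y w

theorem actNeg_wedge (y : L.gneg) (x : L.gpos) (m : W.Kac') :
    W.actNeg y (wedge ℂ L.gpos _ x m) =
      W.actZero (L.bracketNegPos y x) m - wedge ℂ L.gpos _ x (W.actNeg y m) :=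
  W.actNegAux_wedge y x m

theorem actZero_bracketZero (h h' : L.g0) (m : W.Kac') :
    W.actZero (L.bracketZero h h') m =
      W.actZero h (W.actZero h' m) - W.actZero h' (W.actZero h m) := by
  induction m using ExteriorTensor.induction with
  | incl w =>
    simp only [actZero_incl, ← map_sub]
    exact congrArg _ (W.act_br h h' w)
  | add m n hm hn => simp only [map_add, hm, hn]; abel
  | wedge x m hm =>
    simp only [actZero_wedge, hm, GLSA.adPos_bracketZero, map_add, map_sub, LinearMap.sub_apply]
    abel

theorem actNeg_adNeg (h : L.g0) (y : L.gneg) (m : W.Kac') :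
    W.actNeg (adNeg L h y) m = W.actZero h (W.actNeg y m) - W.actNeg y (W.actZero h m) := by
  induction m using ExteriorTensor.induction with
  | incl w => simp only [actNeg_incl, actZero_incl, map_zero, sub_zero]
  | add m n hm hn => simp only [map_add, hm, hn]; abel
  | wedge x m hm =>
    have h₁ := W.actZero_bracketZero h (L.bracketNegPos y x) m
    rw [GLSA.bracketZero_bracketNegPos, map_add, LinearMap.add_apply, ← eq_sub_iff_add_eq] at h₁
    simp only [actZero_wedge, actNeg_wedge, hm, h₁, map_add, map_sub]
    abel

theorem actNeg_swap (y y' : L.gneg) (m : W.Kac') :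
    W.actNeg y (W.actNeg y' m) + W.actNeg y' (W.actNeg y m) = 0 := by
  induction m using ExteriorTensor.induction with
  | incl w => simp only [actNeg_incl, map_zero, add_zero]
  | add m n hm hn =>
    simp only [map_add]
    rw [add_add_add_comm, hm, hn, add_zero]
  | wedge x m hm =>
    have h₁ := W.actNeg_adNeg (L.bracketNegPos y x) y' m
    have h₂ := W.actNeg_adNeg (L.bracketNegPos y' x) y m
    have h₃ : W.actNeg (adNeg L (L.bracketNegPos y x) y') m +
        W.actNeg (adNeg L (L.bracketNegPos y' x) y) m = 0 := by
      rw [← LinearMap.add_apply, ← map_add, GLSA.adNeg_bracketNegPos, map_zero,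
        LinearMap.zero_apply]
    have h₄ : wedge ℂ L.gpos _ x (W.actNeg y (W.actNeg y' m)) +
        wedge ℂ L.gpos _ x (W.actNeg y' (W.actNeg y m)) = 0 := by rw [← map_add, hm, map_zero]
    rw [h₁, h₂] at h₃
    simp only [actNeg_wedge, map_sub]
    linear_combination (norm := module) h₄ - h₃

/-- The action of `𝔤` on `Λ(𝔤₁) ⊗ W`. -/
def actKac' : L.carrier →ₗ[ℂ] Module.End ℂ W.Kac' :=
  W.actZero ∘ₗ L.g0.projectionOnto _ L.oddCompl + (W.actNeg ∘ₗ L.gneg.projectionOnto _ L.isCompl_gneg +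
    wedge ℂ L.gpos _ ∘ₗ L.gpos.projectionOnto _ L.isCompl_gpos)

theorem actKac'_zero (h : L.g0) : W.actKac' h = W.actZero h := by
  have h₁ := (Submodule.projectionOnto_apply_eq_zero_iff L.isCompl_gneg).2
    ((le_sup_left : L.g0 ≤ L.g0 ⊔ L.gpos) h.2)
  have h₂ := (Submodule.projectionOnto_apply_eq_zero_iff L.isCompl_gpos).2
    ((le_sup_left : L.g0 ≤ L.g0 ⊔ L.gneg) h.2)
  simp [actKac', h₁, h₂]

theorem actKac'_neg (y : L.gneg) : W.actKac' y = W.actNeg y := by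
  have h₁ := (Submodule.projectionOnto_apply_eq_zero_iff L.oddCompl).2 (L.gneg_le_odd y.2)
  have h₂ := (Submodule.projectionOnto_apply_eq_zero_iff L.isCompl_gpos).2
    ((le_sup_right : L.gneg ≤ L.g0 ⊔ L.gneg) y.2)
  simp [actKac', h₁, h₂]

theorem actKac'_pos (x : L.gpos) : W.actKac' x = wedge ℂ L.gpos _ x := by
  have h₁ := (Submodule.projectionOnto_apply_eq_zero_iff L.oddCompl).2 (L.gpos_le_odd x.2)
  have h₂ := (Submodule.projectionOnto_apply_eq_zero_iff L.isCompl_gneg).2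
    ((le_sup_right : L.gpos ≤ L.g0 ⊔ L.gpos) x.2)
  simp [actKac', h₁, h₂]

/-- The parity involution of `Λ(𝔤₁) ⊗ W`. -/
def parityKac' : Module.End ℂ W.Kac' := anti L.gpos W.parity

theorem parityKac'_incl (w : W.carrier) :
    W.parityKac' (incl ℂ L.gpos _ w) = incl ℂ L.gpos _ (W.parity w) := anti_incl _ _

theorem parityKac'_wedge (x : L.gpos) (m : W.Kac') :
    W.parityKac' (wedge ℂ L.gpos _ x m) = -wedge ℂ L.gpos _ x (W.parityKac' m) := anti_wedge _ _ _

theorem parityKac'_parityKac' (m : W.Kac') : W.parityKac' (W.parityKac' m) = m := by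
  induction m using ExteriorTensor.induction with
  | incl w => rw [parityKac'_incl, parityKac'_incl, parity, parityInv_parityInv]
  | add m n hm hn => rw [map_add, map_add, hm, hn]
  | wedge x m hm => rw [parityKac'_wedge, map_neg, parityKac'_wedge, hm, neg_neg]

theorem parityKac'_actZero (h : L.g0) (m : W.Kac') :
    W.parityKac' (W.actZero h m) = W.actZero h (W.parityKac' m) := by
  induction m using ExteriorTensor.induction with
  | incl w => simp only [parityKac'_incl, actZero_incl, act_parity]
  | add m n hm hn => simp only [map_add, hm, hn]
  | wedge x m hm =>
    simp only [parityKac'_wedge, actZero_wedge, map_add, map_neg, hm]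
    abel

theorem parityKac'_actNeg (y : L.gneg) (m : W.Kac') :
    W.parityKac' (W.actNeg y m) = -W.actNeg y (W.parityKac' m) := by
  induction m using ExteriorTensor.induction with
  | incl w => simp only [parityKac'_incl, actNeg_incl, map_zero, neg_zero]
  | add m n hm hn => simp only [map_add, hm, hn]; abel
  | wedge x m hm =>
    simp only [parityKac'_wedge, actNeg_wedge, map_sub, map_neg, hm, parityKac'_actZero]
    abel

theorem parityKac'_odd {z : L.carrier} (hz : z ∈ L.odd) (m : W.Kac') :
    W.parityKac' (W.actKac' z m) = -W.actKac' z (W.parityKac' m) := by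
  obtain ⟨b, c, rfl⟩ := GLSA.exists_eq_add_of_mem_odd hz
  simp only [map_add, LinearMap.add_apply, actKac'_neg, actKac'_pos, parityKac'_actNeg,
    parityKac'_wedge, neg_add]

theorem actKac'_bracket_zero (h : L.g0) (z : L.carrier) (m : W.Kac') :
    W.actKac' (L.bracket h z) m =
      W.actKac' h (W.actKac' z m) - W.actKac' z (W.actKac' h m) := by
  obtain ⟨a, b, c, rfl⟩ := GLSA.exists_eq_add z
  have h₁ : L.bracket h a = L.bracketZero h a := rfl
  simp only [map_add, LinearMap.add_apply, h₁, ← GLSA.coe_adNeg, ← GLSA.coe_adPos, actKac'_zero,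
    actKac'_neg, actKac'_pos, actZero_bracketZero, actNeg_adNeg, actZero_wedge]
  abel

theorem actKac'_bracket_odd {x y : L.carrier} (hx : x ∈ L.odd) (hy : y ∈ L.odd) (m : W.Kac') :
    W.actKac' (L.bracket x y) m =
      W.actKac' x (W.actKac' y m) + W.actKac' y (W.actKac' x m) := by
  obtain ⟨b, c, rfl⟩ := GLSA.exists_eq_add_of_mem_odd hx
  obtain ⟨b', c', rfl⟩ := GLSA.exists_eq_add_of_mem_odd hy
  have h₁ := L.skew_oo c (L.gpos_le_odd c.2) b' (L.gneg_le_odd b'.2)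
  have h₂ := W.actNeg_swap b b' m
  have h₃ := wedge_swap c c' m
  simp only [map_add, LinearMap.add_apply, h₁, L.br_nn b b.2 b' b'.2, L.br_pp c c.2 c' c'.2,
    ← GLSA.coe_bracketNegPos, actKac'_zero, actKac'_neg, actKac'_pos, actNeg_wedge, map_zero,
    LinearMap.zero_apply]
  linear_combination (norm := module) -h₂ - h₃

/-- The opposite Kac module of `W`, realised on `Λ(𝔤₁) ⊗ W`. -/
abbrev kac' : SMod L where
  carrier := W.Kac'
  act := W.actKac'
  ev := LinearMap.eqLocus W.parityKac' LinearMap.id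
  od := LinearMap.eqLocus W.parityKac' (-LinearMap.id)
  grading := isCompl_of_involutive W.parityKac'_parityKac'
  act_e_ev x hx m hm := by
    lift x to L.g0 using hx
    simp only [LinearMap.mem_eqLocus, LinearMap.id_apply] at hm ⊢
    rw [actKac'_zero, parityKac'_actZero, hm]
  act_e_od x hx m hm := by
    lift x to L.g0 using hx
    simp only [LinearMap.mem_eqLocus, LinearMap.id_apply, LinearMap.neg_apply] at hm ⊢
    rw [actKac'_zero, parityKac'_actZero, hm, map_neg]
  act_o_ev x hx m hm := by
    simp only [LinearMap.mem_eqLocus, LinearMap.id_apply, LinearMap.neg_apply] at hm ⊢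
    rw [parityKac'_odd W hx, hm]
  act_o_od x hx m hm := by
    simp only [LinearMap.mem_eqLocus, LinearMap.id_apply, LinearMap.neg_apply] at hm ⊢
    rw [parityKac'_odd W hx, hm, map_neg, neg_neg]
  act_br_e x y hxy m := by
    rcases hxy with hx | hy
    · exact W.actKac'_bracket_zero ⟨x, hx⟩ y m
    · have h₁ := L.skew_e y hy x
      have h₂ := W.actKac'_bracket_zero ⟨y, hy⟩ x m
      rw [← neg_eq_iff_eq_neg] at h₁
      rw [← h₁, map_neg, LinearMap.neg_apply, h₂, neg_sub]
  act_br_oo x hx y hy m := W.actKac'_bracket_odd hx hy m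

theorem kac'_act_zero (h : L.g0) (m : W.Kac') : W.kac'.act h m = W.actZero h m :=
  LinearMap.congr_fun (W.actKac'_zero h) m

theorem kac'_act_neg (y : L.gneg) (m : W.Kac') : W.kac'.act y m = W.actNeg y m :=
  LinearMap.congr_fun (W.actKac'_neg y) m

theorem kac'_act_pos (x : L.gpos) (m : W.Kac') : W.kac'.act x m = wedge ℂ L.gpos _ x m :=
  LinearMap.congr_fun (W.actKac'_pos x) m

theorem mem_kac'_ev {m : W.Kac'} : m ∈ W.kac'.ev ↔ W.parityKac' m = m := Iff.rfl

theorem mem_kac'_od {m : W.Kac'} : m ∈ W.kac'.od ↔ W.parityKac' m = -m := Iff.rfl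

theorem kac'_hom_ext {N : SMod L} {Φ Ψ : SHom W.kac' N}
    (h : ∀ w, Φ.toLin (incl ℂ L.gpos _ w) = Ψ.toLin (incl ℂ L.gpos _ w)) : Φ.toLin = Ψ.toLin := by
  refine hom_ext (k := ℂ) h fun x m hm => ?_
  have h₁ : Φ.toLin (wedge ℂ L.gpos _ x m) = N.act x (Φ.toLin m) := by
    rw [← Φ.equivar]
    exact congrArg _ (W.kac'_act_pos x m).symm
  have h₂ : Ψ.toLin (wedge ℂ L.gpos _ x m) = N.act x (Ψ.toLin m) := by
    rw [← Ψ.equivar]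
    exact congrArg _ (W.kac'_act_pos x m).symm
  exact h₁.trans ((congrArg _ hm).trans h₂.symm)

/-- The opposite Kac module maps to any supermodule to which its inducing module maps. -/
theorem exists_kac'_hom (N : SMod L) (φ : W.carrier →ₗ[ℂ] N.carrier)
    (hev : ∀ w ∈ W.ev, φ w ∈ N.ev) (hod : ∀ w ∈ W.od, φ w ∈ N.od)
    (hzero : ∀ (x : L.g0) (w : W.carrier), φ (W.act x w) = N.act x (φ w))
    (hneg : ∀ y ∈ L.gneg, ∀ w : W.carrier, N.act y (φ w) = 0) :
    ∃ Φ : SHom W.kac' N, ∀ w, Φ.toLin (incl ℂ L.gpos _ w) = φ w := by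
  have hsq (x : L.gpos) (m : W.Kac') (n : N.carrier) :
      (0 : L.gpos →ₗ[ℂ] W.Kac' →ₗ[ℂ] N.carrier) x (wedge ℂ L.gpos _ x m) +
      (N.act ∘ₗ L.gpos.subtype) x ((0 : L.gpos →ₗ[ℂ] W.Kac' →ₗ[ℂ] N.carrier) x m +
        (N.act ∘ₗ L.gpos.subtype) x n) = 0 := by
    have := N.act_br_oo x (L.gpos_le_odd x.2) x (L.gpos_le_odd x.2) n
    rw [L.br_pp x x.2 x x.2, map_zero, LinearMap.zero_apply] at this
    simpa using eq_zero_of_eq_neg ℂ (eq_neg_of_add_eq_zero_left this.symm)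
  let G : W.Kac' →ₗ[ℂ] N.carrier := fold φ hsq
  have hG_incl (w) : G (incl ℂ L.gpos _ w) = φ w := fold_incl _ _ _
  have hG_wedge (x : L.gpos) (m) : G (wedge ℂ L.gpos _ x m) = N.act x (G m) :=
    (fold_wedge _ _ _ _).trans (by simp [G])
  have hG_zero (h : L.g0) (m) : G (W.actZero h m) = N.act h (G m) := by
    induction m using ExteriorTensor.induction with
    | incl w => rw [actZero_incl, hG_incl, hG_incl, hzero]
    | add m n hm hn => rw [map_add, map_add, hm, hn, map_add, map_add]
    | wedge x m hm =>
      have := N.act_br_e h x (Or.inl h.2) (G m)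
      rw [actZero_wedge, map_add, hG_wedge, hG_wedge, hG_wedge, hm, GLSA.coe_adPos, this,
        sub_add_cancel]
  have hG_neg (y : L.gneg) (m) : G (W.actNeg y m) = N.act y (G m) := by
    induction m using ExteriorTensor.induction with
    | incl w => rw [actNeg_incl, hG_incl, hneg y y.2, map_zero]
    | add m n hm hn => rw [map_add, map_add, hm, hn, map_add, map_add]
    | wedge x m hm =>
      have := N.act_br_oo y (L.gneg_le_odd y.2) x (L.gpos_le_odd x.2) (G m)
      rw [actNeg_wedge, map_sub, hG_zero, hG_wedge, hG_wedge, hm, GLSA.coe_bracketNegPos, this,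
        add_sub_cancel_right]
  have hG_parity (m) : G (W.parityKac' m) = parityInv N.grading (G m) := by
    induction m using ExteriorTensor.induction with
    | incl w => rw [parityKac'_incl, hG_incl, hG_incl, map_parityInv W.grading N.grading hev hod]
    | add m n hm hn => rw [map_add, map_add, hm, hn, map_add, map_add]
    | wedge x m hm =>
      rw [parityKac'_wedge, map_neg, hG_wedge, hG_wedge, hm,
        map_parityInv_odd N.grading N.grading (N.act_o_ev x (L.gpos_le_odd x.2))
          (N.act_o_od x (L.gpos_le_odd x.2)), neg_neg]
  refine ⟨⟨G, fun m hm => ?_, fun m hm => ?_, fun z m => ?_⟩, hG_incl⟩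
  · rw [mem_ev_iff N.grading, ← hG_parity, W.mem_kac'_ev.1 hm]
  · rw [mem_od_iff N.grading, ← hG_parity, W.mem_kac'_od.1 hm, map_neg]
  · change G (W.actKac' z m) = N.act z (G m)
    obtain ⟨a, b, c, rfl⟩ := GLSA.exists_eq_add z
    simp only [map_add, LinearMap.add_apply, actKac'_zero, actKac'_neg, actKac'_pos]
    rw [hG_zero, hG_neg, hG_wedge]

theorem exists_kac'_equiv {K : SMod L} {η : W.carrier →ₗ[ℂ] K.carrier} (hK : IsKac' W K η) :
    ∃ (F : SHom K W.kac') (G : SHom W.kac' K),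
      (∀ m, G.toLin (F.toLin m) = m) ∧ ∀ m, F.toLin (G.toLin m) = m := by
  obtain ⟨F, hF, -⟩ := hK.universal W.kac' (incl ℂ L.gpos W.carrier)
    (fun w hw => W.mem_kac'_ev.2 (by rw [parityKac'_incl, parity, parityInv_of_mem_ev _ hw]))
    (fun w hw => W.mem_kac'_od.2
      (by rw [parityKac'_incl, parity, parityInv_of_mem_od _ hw, map_neg]))
    (fun x w => by rw [kac'_act_zero]; exact (W.actZero_incl x w).symm)
    (fun y hy w => (W.kac'_act_neg ⟨y, hy⟩ _).trans (W.actNeg_incl _ _))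
  obtain ⟨G, hG⟩ := W.exists_kac'_hom K η hK.map_ev hK.map_od hK.equivar hK.neg_zero
  refine ⟨F, G, fun m => ?_, fun m => ?_⟩
  · have := (hK.universal K η hK.map_ev hK.map_od hK.equivar hK.neg_zero).unique
      (y₁ := G.comp F) (y₂ := SHom.id K) (fun v => ?_) fun v => rfl
    · exact congrArg (fun f : SHom K K => f.toLin m) this
    · exact (congrArg _ (hF v)).trans (hG v)
  · have := W.kac'_hom_ext (Φ := F.comp G) (Ψ := SHom.id W.kac') fun w => ?_
    · exact LinearMap.congr_fun this m
    · exact (congrArg _ (hG w)).trans (hF w)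

theorem isTwistBy_parity_iff (W V : SMod0 L) (e : W.carrier →ₗ[ℂ] V.carrier) :
    (if parPos L then (∀ v ∈ W.ev, e v ∈ V.od) ∧ (∀ v ∈ W.od, e v ∈ V.ev)
      else (∀ v ∈ W.ev, e v ∈ V.ev) ∧ (∀ v ∈ W.od, e v ∈ V.od)) ↔
    ∀ w, V.parity (e w) = (-1 : ℂ) ^ Module.finrank ℂ L.gpos • e (W.parity w) := by
  rcases Nat.even_or_odd (Module.finrank ℂ L.gpos) with hn | hn
  · have hp : parPos L = false := by simp [parPos, Nat.even_iff.1 hn]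
    rw [hp, hn.neg_one_pow]
    simp only [Bool.false_eq_true, if_false, one_smul]
    refine ⟨fun h w => (map_parityInv W.grading V.grading h.1 h.2 w).symm, fun h =>
      ⟨fun w hw => ?_, fun w hw => ?_⟩⟩
    · rw [mem_ev_iff V.grading, h, parity, parityInv_of_mem_ev _ hw]
    · rw [mem_od_iff V.grading, h, parity, parityInv_of_mem_od _ hw, map_neg]
  · have hp : parPos L = true := by simp [parPos, Nat.odd_iff.1 hn]
    rw [hp, hn.neg_one_pow]
    simp only [if_true, neg_smul, one_smul]
    refine ⟨fun h w => ?_, fun h => ⟨fun w hw => ?_, fun w hw => ?_⟩⟩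
    · exact (neg_eq_iff_eq_neg.2 (map_parityInv_odd W.grading V.grading h.1 h.2 w)).symm
    · rw [mem_od_iff V.grading, h, parity, parityInv_of_mem_ev _ hw]
    · rw [mem_ev_iff V.grading, h, parity, parityInv_of_mem_od _ hw, map_neg, neg_neg]

/-- A version of Schur's lemma: a nonzero linear map between simple supermodules which is
equivariant up to a character and homogeneous is bijective. -/
theorem IsSimple.bijective {V W : SMod0 L} (hV : V.IsSimple) (hW : W.IsSimple)
    {t : V.carrier →ₗ[ℂ] W.carrier} (ht : t ≠ 0) (χ : L.g0 → ℂ) (c : ℂ)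
    (hact : ∀ x v, t (V.act x v) = χ x • t v + W.act x (t v))
    (hpar : ∀ v, W.parity (t v) = c • t (V.parity v)) (hc : c ≠ 0) : Function.Bijective t := by
  have hpar' (v) : t (V.parity v) = c⁻¹ • W.parity (t v) := by rw [hpar, inv_smul_smul₀ hc]
  constructor
  · rw [← LinearMap.ker_eq_bot]
    refine (hV.2 _ ⟨fun x v hv => ?_, le_sup_of_parityInv_mem V.grading fun v hv => ?_⟩).resolve_right
      fun h => ht (LinearMap.ker_eq_top.1 h)
    · rw [LinearMap.mem_ker] at hv ⊢
      rw [hact, hv, smul_zero, map_zero, add_zero]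
    · rw [LinearMap.mem_ker] at hv ⊢
      rw [hpar', hv, map_zero, smul_zero]
  · rw [← LinearMap.range_eq_top]
    refine (hW.2 _ ⟨fun x w hw => ?_, le_sup_of_parityInv_mem W.grading fun w hw => ?_⟩).resolve_left
      fun h => ht (LinearMap.range_eq_bot.1 h)
    · obtain ⟨v, rfl⟩ := hw
      exact ⟨V.act x v - χ x • v, by rw [map_sub, hact, map_smul, add_sub_cancel_left]⟩
    · obtain ⟨v, rfl⟩ := hw
      exact ⟨c • V.parity v, by rw [map_smul, ← hpar]⟩

section top

variable [FiniteDimensional ℂ L.gpos]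

/-- The embedding of `W` in the opposite Kac module as `Λ^max(𝔤₁) ⊗ W`. -/
def topKac' : W.carrier →ₗ[ℂ] W.Kac' :=
  ExteriorTensor.top (Module.finBasis ℂ L.gpos) W.carrier

theorem exists_leftInverse_topKac' :
    ∃ p : W.Kac' →ₗ[ℂ] W.carrier, ∀ w, p (W.topKac' w) = w :=
  ⟨topCoeff (Module.finBasis ℂ L.gpos) W.carrier, topCoeff_top _⟩

theorem actZero_topKac' (h : L.g0) (w : W.carrier) :
    W.actZero h (W.topKac' w) = W.topKac' (traceCharPos L h • w + W.act h w) := by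
  rw [map_add, map_smul]
  exact der_top _ _ _ _

theorem parityKac'_topKac' (w : W.carrier) :
    W.parityKac' (W.topKac' w) =
      W.topKac' ((-1 : ℂ) ^ Module.finrank ℂ L.gpos • W.parity w) := by
  rw [map_smul]
  exact anti_top _ _ _

theorem mem_range_topKac' {m : W.Kac'} :
    (∃ w, W.topKac' w = m) ↔ ∀ x : L.gpos, wedge ℂ L.gpos _ x m = 0 :=
  ⟨by rintro ⟨w, rfl⟩ x; exact wedge_top _ _ _, exists_top_eq _⟩

end top

end SMod0

end superalgebra

/-- Let `V` and `W` be simple `𝔤₀`-supermodules.  There exists a non-zero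
homomorphism of `𝔤`-supermodules from `K(V)` to `K'(W)` if and only if
`V ≅ Λ^max(𝔤₁) ⊗ W` as `𝔤₀`-supermodules. -/
theorem statement_3 (L : GLSA)
    [FiniteDimensional ℂ ↥L.gneg] [FiniteDimensional ℂ ↥L.gpos]
    (V W : SMod0 L) (hV : V.IsSimple) (hW : W.IsSimple)
    (K : SMod L) (η : V.carrier →ₗ[ℂ] K.carrier) (hK : IsKac V K η)
    (K' : SMod L) (η' : W.carrier →ₗ[ℂ] K'.carrier) (hK' : IsKac' W K' η') :
    (∃ f : SHom K K', f.toLin ≠ 0) ↔ IsTwistBy W V (traceCharPos L) (parPos L) := by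
  obtain ⟨F, G, hGF, hFG⟩ := W.exists_kac'_equiv hK'
  obtain ⟨p, hp⟩ := W.exists_leftInverse_topKac'
  have hc : (-1 : ℂ) ^ finrank ℂ L.gpos ≠ 0 := pow_ne_zero _ (by norm_num)
  constructor
  · rintro ⟨f, hf⟩
    let Φ : SHom K W.kac' := F.comp f
    let φ : V.carrier →ₗ[ℂ] W.Kac' := Φ.toLin ∘ₗ η
    have hφ_ne : φ ≠ 0 := fun h => hf <| by
      have h₀ (v) : Φ.toLin (η v) = 0 := LinearMap.congr_fun h v
      have := (hK.universal W.kac' 0 (fun v _ => zero_mem _) (fun v _ => zero_mem _)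
        (fun x v => by simp) (fun x _ v => by simp)).unique (y₁ := Φ)
        (y₂ := ⟨0, fun v _ => zero_mem _, fun v _ => zero_mem _, fun x v => by simp⟩) h₀
        fun v => rfl
      ext m
      rw [← hGF (f.toLin m), LinearMap.zero_apply, ← map_zero G.toLin]
      exact congrArg _ (congrArg (fun g : SHom K W.kac' => g.toLin m) this)
    have hφ_zero (x : L.g0) (v) : φ (V.act x v) = W.actZero x (φ v) := by
      rw [← W.kac'_act_zero]
      exact (congrArg _ (hK.equivar x v)).trans (Φ.equivar x _)
    have hφ_pos (v) : ∃ w, W.topKac' w = φ v := W.mem_range_topKac'.2 fun x => by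
      rw [← W.kac'_act_pos]
      exact (Φ.equivar x _).symm.trans ((congrArg _ (hK.pos_zero x x.2 v)).trans (map_zero _))
    have hφ_parity (v) : W.parityKac' (φ v) = φ (V.parity v) := by
      obtain ⟨a, ha, b, hb, rfl⟩ := exists_add_of_grading V.grading v
      have h₁ := W.mem_kac'_ev.1 (Φ.map_ev _ (hK.map_ev a ha))
      have h₂ := W.mem_kac'_od.1 (Φ.map_od _ (hK.map_od b hb))
      simp only [map_add, SMod0.parity, parityInv_of_mem_ev V.grading ha,
        parityInv_of_mem_od V.grading hb, map_neg]
      exact congrArg₂ _ h₁ h₂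
    let t : V.carrier →ₗ[ℂ] W.carrier := p ∘ₗ φ
    have ht (v) : W.topKac' (t v) = φ v := by
      obtain ⟨w, hw⟩ := hφ_pos v
      rw [LinearMap.comp_apply, ← hw, hp]
    have hinj : Injective W.topKac' := LeftInverse.injective hp
    have ht_ne : t ≠ 0 := fun h => hφ_ne <| by
      ext v
      rw [← ht, h, LinearMap.zero_apply, LinearMap.zero_apply, map_zero]
    have ht_act (x : L.g0) (v) : t (V.act x v) = traceCharPos L x • t v + W.act x (t v) :=
      hinj (by rw [ht, hφ_zero, ← ht, W.actZero_topKac'])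
    have ht_par (v) : W.parity (t v) = (-1 : ℂ) ^ finrank ℂ L.gpos • t (V.parity v) := by
      rw [← inv_smul_eq_iff₀ hc, ← inv_pow, inv_neg_one]
      exact hinj (by rw [ht, ← hφ_parity, ← ht, W.parityKac'_topKac'])
    let e := (LinearEquiv.ofBijective t (hV.bijective hW ht_ne _ _ ht_act ht_par hc)).symm
    have he (w) : t (e w) = w := LinearEquiv.apply_symm_apply
      (LinearEquiv.ofBijective t (hV.bijective hW ht_ne _ _ ht_act ht_par hc)) w
    have htinj : Injective t := (hV.bijective hW ht_ne _ _ ht_act ht_par hc).1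
    refine ⟨e, fun x w => htinj ?_, (SMod0.isTwistBy_parity_iff W V e).2 fun w => htinj ?_⟩
    · rw [ht_act, map_add, map_smul, he, he, add_comm]
    · rw [LinearEquiv.coe_coe, map_smul, he, ← inv_smul_eq_iff₀ hc, ← inv_pow, inv_neg_one,
        ← ht_par, he]
  · rintro ⟨e, he, hpar⟩
    replace hpar := (SMod0.isTwistBy_parity_iff W V e).1 hpar
    let φ : V.carrier →ₗ[ℂ] W.Kac' := W.topKac' ∘ₗ e.symm.toLinearMap
    have hφ (w) : φ (e w) = W.topKac' w := congrArg W.topKac' (e.symm_apply_apply w)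
    have hφ_parity (v) : W.parityKac' (φ v) = φ (V.parity v) := by
      obtain ⟨w, rfl⟩ := e.surjective v
      have := hpar w
      rw [LinearEquiv.coe_coe] at this
      rw [hφ, this, map_smul, hφ, W.parityKac'_topKac', map_smul]
    obtain ⟨Φ, hΦ, -⟩ := hK.universal W.kac' φ
      (fun v hv => W.mem_kac'_ev.2 <| by
        rw [hφ_parity, SMod0.parity, parityInv_of_mem_ev V.grading hv])
      (fun v hv => W.mem_kac'_od.2 <| by
        rw [hφ_parity, SMod0.parity, parityInv_of_mem_od V.grading hv, map_neg])
      (fun x v => by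
        obtain ⟨w, rfl⟩ := e.surjective v
        rw [W.kac'_act_zero, he, map_add, map_smul, hφ, hφ, W.actZero_topKac', map_add, map_smul,
          add_comm])
      (fun x hx v => (W.kac'_act_pos ⟨x, hx⟩ _).trans (W.mem_range_topKac'.1 ⟨_, rfl⟩ _))
    refine ⟨G.comp Φ, fun h => hV.1 ?_⟩
    refine (Submodule.eq_bot_iff _).2 fun v _ => ?_
    have h₁ : G.toLin (φ v) = 0 := (congrArg _ (hΦ v)).symm.trans (LinearMap.congr_fun h (η v))
    have h₂ : φ v = 0 := (hFG _).symm.trans ((congrArg _ h₁).trans (map_zero _))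
    have h₃ : p (φ v) = e.symm v := hp _
    rw [h₂, map_zero, eq_comm] at h₃
    exact e.symm.map_eq_zero_iff.1 h₃
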